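/- Let (L0, …, Lk) be a levelling in a graph G satisfying: Lk is stable; all induced paths between any two fixed vertices of Lk with interior in L0 ∪ ⋯ ∪ L(k−1) have the same parity; and adjacent vertices within any level Li (1 ≤ i ≤ k−1) have the same set of parents. If u, v ∈ Li are adjacent (siblings) for some 1 ≤ i ≤ k, and in addition every vertex of each level L_j (j < k) has a 'dependent' in L_{j+1} (a vertex of which it is the only parent), and the graph H on Lk joining pairs connected by an odd induced path with interior in L0 ∪ ⋯ ∪ L(k−1) has exactly 3 edges forming an induced P4, then u and v have a unique common parent. -/

import Mathlib

open SimpleGraph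

universe u

variable {V : Type u}

/-- The independence (stability) number of a graph. -/
noncomputable def indepNum (G : SimpleGraph V) : ℕ :=
  sSup {n | ∃ s : Finset V, s.card = n ∧ ∀ x ∈ s, ∀ y ∈ s, x ≠ y → ¬ G.Adj x y}

/-- A walk is induced: any edge of `G` between vertices of the walk is an edge of the walk. -/
def IsInducedWalk (G : SimpleGraph V) {u v : V} (p : G.Walk u v) : Prop :=
  ∀ x ∈ p.support, ∀ y ∈ p.support, G.Adj x y → p.toSubgraph.Adj x y

/-- An induced path. -/
def IsInducedPath (G : SimpleGraph V) {u v : V} (p : G.Walk u v) : Prop :=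
  p.IsPath ∧ IsInducedWalk G p

/-- An odd hole: an induced cycle of odd length at least 5. -/
def HasOddHole (G : SimpleGraph V) : Prop :=
  ∃ (v : V) (p : G.Walk v v), p.IsCycle ∧ IsInducedWalk G p ∧ Odd p.length ∧ 5 ≤ p.length

/-- A cograph: no induced path on four vertices. -/
def IsCograph (G : SimpleGraph V) : Prop :=
  ¬ ∃ a b c d : V, a ≠ c ∧ a ≠ d ∧ b ≠ d ∧
    G.Adj a b ∧ G.Adj b c ∧ G.Adj c d ∧ ¬ G.Adj a c ∧ ¬ G.Adj a d ∧ ¬ G.Adj b d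

/-- A levelling `(L 0, …, L k)` in `G`. -/
def IsLevelling (G : SimpleGraph V) (k : ℕ) (L : ℕ → Set V) : Prop :=
  (∀ i j, i ≤ k → j ≤ k → i ≠ j → Disjoint (L i) (L j)) ∧
  (∃ x, L 0 = {x}) ∧
  (∀ i, 1 ≤ i → i ≤ k → ∀ v ∈ L i,
     (∃ u ∈ L (i - 1), G.Adj u v) ∧ (∀ h, h + 1 < i → ∀ u ∈ L h, ¬ G.Adj u v))

/-- The interior (internal vertices) of a walk is contained in `S`. -/
def InteriorIn (G : SimpleGraph V) {u v : V} (p : G.Walk u v) (S : Set V) : Prop :=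
  ∀ x ∈ p.support, x ≠ u → x ≠ v → x ∈ S

/-- The union `L 0 ∪ ⋯ ∪ L (k-1)`. -/
def lowerLevels (L : ℕ → Set V) (k : ℕ) : Set V := ⋃ i ∈ Finset.range k, L i

/-- There is an odd induced path between `u` and `v` with interior in the lower levels. -/
def OddConn (G : SimpleGraph V) (L : ℕ → Set V) (k : ℕ) (u v : V) : Prop :=
  u ≠ v ∧ ∃ p : G.Walk u v, IsInducedPath G p ∧ Odd p.length ∧
    InteriorIn G p (lowerLevels L k)

/-- `w ∈ L (i+1)` is a dependent of `u ∈ L i`: `u` is its only parent. -/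
def IsDependent (G : SimpleGraph V) (L : ℕ → Set V) (i : ℕ) (u w : V) : Prop :=
  w ∈ L (i + 1) ∧ G.Adj u w ∧ ∀ x ∈ L i, G.Adj x w → x = u

section InducedPaths

variable {G : SimpleGraph V}

/-- A new first vertex whose only neighbour on an induced path is the first one extends it. -/
theorem IsInducedPath.cons {x y z : V} {p : G.Walk y z} (hp : IsInducedPath G p)
    (h : G.Adj x y) (hx : x ∉ p.support) (hn : ∀ t ∈ p.support, G.Adj x t → t = y) :
    IsInducedPath G (Walk.cons h p) := by
  refine ⟨hp.1.cons hx, ?_⟩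
  intro s hs t ht hst
  rw [Walk.support_cons, List.mem_cons] at hs ht
  rw [Walk.toSubgraph, Subgraph.sup_adj]
  rcases hs with rfl | hs
  · rcases ht with rfl | ht
    · exact absurd rfl hst.ne
    · left
      simp [hn t ht hst]
  · rcases ht with rfl | ht
    · left
      simp [hn s hs hst.symm]
    · exact Or.inr (hp.2 s hs t ht hst)

theorem IsInducedPath.reverse {x y : V} {p : G.Walk x y} (hp : IsInducedPath G p) :
    IsInducedPath G p.reverse := by
  refine ⟨hp.1.reverse, ?_⟩
  intro s hs t ht hst
  rw [Walk.toSubgraph_reverse]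
  exact hp.2 s (by simpa using hs) t (by simpa using ht) hst

theorem IsInducedPath.nil (x : V) : IsInducedPath G (Walk.nil : G.Walk x x) := by
  refine ⟨Walk.IsPath.nil, ?_⟩
  intro s hs t ht hst
  simp only [Walk.support_nil, List.mem_singleton] at hs ht
  subst hs
  subst ht
  exact absurd rfl hst.ne

theorem IsInducedPath.tail {x y z : V} {h : G.Adj x y} {p : G.Walk y z}
    (hp : IsInducedPath G (Walk.cons h p)) : IsInducedPath G p := by
  have hpath := (Walk.cons_isPath_iff h p).1 hp.1
  refine ⟨hpath.1, ?_⟩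
  intro s hs t ht hst
  have := hp.2 s (by simp [hs]) t (by simp [ht]) hst
  rw [Walk.toSubgraph, Subgraph.sup_adj] at this
  rcases this with hadj | hadj
  · rw [subgraphOfAdj_adj, Sym2.eq_iff] at hadj
    rcases hadj with ⟨rfl, -⟩ | ⟨rfl, -⟩
    · exact absurd hs hpath.2
    · exact absurd ht hpath.2
  · exact hadj

/-- The first vertex of an induced path is adjacent only to the second one. -/
theorem IsInducedPath.eq_snd_of_adj {x y z t : V} {h : G.Adj x y} {p : G.Walk y z}
    (hp : IsInducedPath G (Walk.cons h p)) (ht : t ∈ p.support) (hxt : G.Adj x t) : t = y := by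
  have hpath := (Walk.cons_isPath_iff h p).1 hp.1
  have := hp.2 x (by simp) t (by simp [ht]) hxt
  rw [Walk.toSubgraph, Subgraph.sup_adj] at this
  rcases this with hadj | hadj
  · rw [subgraphOfAdj_adj, Sym2.eq_iff] at hadj
    rcases hadj with ⟨-, rfl⟩ | ⟨rfl, -⟩
    · rfl
    · exact absurd ht hpath.2
  · exact absurd ((Walk.mem_verts_toSubgraph p).1 hadj.fst_mem) hpath.2

/-- A walk that is shortest among the walks inside its own support is an induced path. -/
theorem isInducedPath_of_shortest {x y : V} (p : G.Walk x y)
    (hmin : ∀ q : G.Walk x y, q.support ⊆ p.support → p.length ≤ q.length) :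
    IsInducedPath G p := by
  classical
  induction p with
  | nil => exact IsInducedPath.nil _
  | @cons x y z h p ih =>
    have hp : IsInducedPath G p := by
      refine ih fun q hq => ?_
      have := hmin (Walk.cons h q) (by
        simp only [Walk.support_cons]
        exact List.cons_subset_cons _ hq)
      simpa using this
    refine hp.cons h ?_ ?_
    · intro hx
      have hlen := hmin (p.dropUntil x hx) fun t ht =>
        List.mem_cons_of_mem _ (p.support_dropUntil_subset_support hx ht)
      have := p.length_dropUntil_le_length hx
      rw [Walk.length_cons] at hlen
      omega
    · intro t ht hxt
      by_contra hty
      have hlen := hmin (Walk.cons hxt (p.dropUntil t ht)) (by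
        simp only [Walk.support_cons]
        exact List.cons_subset_cons _ (p.support_dropUntil_subset_support ht))
      have hsplit := congrArg Walk.length (p.take_spec ht)
      rw [Walk.length_append] at hsplit
      have hpos : (p.takeUntil t ht).length ≠ 0 := fun h0 =>
        hty (Walk.eq_of_length_eq_zero h0).symm
      simp only [Walk.length_cons] at hlen
      omega

/-- Every walk contains an induced path in its support. -/
theorem exists_isInducedPath_support_subset {x y : V} (p : G.Walk x y) :
    ∃ q : G.Walk x y, IsInducedPath G q ∧ q.support ⊆ p.support := by
  induction hn : p.length using Nat.strong_induction_on generalizing p with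
  | _ n ih =>
    by_cases hmin : ∀ q : G.Walk x y, q.support ⊆ p.support → p.length ≤ q.length
    · exact ⟨p, isInducedPath_of_shortest p hmin, List.Subset.refl _⟩
    · push Not at hmin
      obtain ⟨q, hq, hlt⟩ := hmin
      obtain ⟨r, hr, hrq⟩ := ih q.length (hn ▸ hlt) q rfl
      exact ⟨r, hr, List.Subset.trans hrq hq⟩

/-- An induced path can be extended by pendant vertices at both ends. -/
theorem IsInducedPath.exists_extend {x x' y y' : V} {p : G.Walk x' y'} (hp : IsInducedPath G p)
    (hx : G.Adj x x') (hy : G.Adj y y') (hxp : x ∉ p.support) (hyp : y ∉ p.support)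
    (hxn : ∀ t ∈ p.support, G.Adj x t → t = x') (hyn : ∀ t ∈ p.support, G.Adj y t → t = y')
    (hne : x ≠ y) (hxy : ¬ G.Adj x y) {S : Set V} (hS : ∀ t ∈ p.support, t ∈ S) :
    ∃ q : G.Walk x y, IsInducedPath G q ∧ q.length = p.length + 2 ∧ InteriorIn G q S := by
  have hq : IsInducedPath G (Walk.cons hy p.reverse) :=
    hp.reverse.cons hy (by simpa using hyp) (by simpa using hyn)
  have hr : IsInducedPath G (Walk.cons hx (Walk.cons hy p.reverse).reverse) := by
    refine hq.reverse.cons hx ?_ ?_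
    · have hxy' : x ≠ y' := fun e => hxp (e ▸ p.end_mem_support)
      simp [hxp, hne, hxy']
    · intro t ht hxt
      simp only [Walk.support_reverse, List.mem_reverse, Walk.support_cons, List.mem_cons] at ht
      rcases ht with rfl | ht
      · exact absurd hxt hxy
      · exact hxn t ht hxt
  refine ⟨_, hr, by simp, ?_⟩
  intro t ht htx hty
  simp only [Walk.support_reverse, List.mem_reverse, Walk.support_cons, List.mem_cons] at ht
  rcases ht with rfl | rfl | ht
  · exact absurd rfl htx
  · exact absurd rfl hty
  · exact hS t ht

theorem OddConn.symm {L : ℕ → Set V} {k : ℕ} {x y : V} (h : OddConn G L k x y) :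
    OddConn G L k y x := by
  obtain ⟨hne, p, hp, hodd, hint⟩ := h
  exact ⟨hne.symm, p.reverse, hp.reverse, by simpa using hodd,
    fun t ht hty htx => hint t (by simpa using ht) htx hty⟩

end InducedPaths

section Levellings

variable {G : SimpleGraph V} {L : ℕ → Set V} {k : ℕ}

theorem mem_lowerLevels {t : V} : t ∈ lowerLevels L k ↔ ∃ j < k, t ∈ L j := by
  simp [lowerLevels]

theorem IsLevelling.of_succ (hlev : IsLevelling G (k + 1) L) : IsLevelling G k L :=
  ⟨fun i j hi hj => hlev.1 i j (by omega) (by omega), hlev.2.1,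
    fun i hi hik => hlev.2.2 i hi (by omega)⟩

theorem IsLevelling.notMem_lowerLevels (hlev : IsLevelling G k L) {x : V} (hx : x ∈ L k) :
    x ∉ lowerLevels L k := by
  rw [mem_lowerLevels]
  rintro ⟨j, hj, hxj⟩
  exact Set.disjoint_left.1 (hlev.1 j k hj.le le_rfl hj.ne) hxj hx

/-- Neighbours of the last level in earlier levels are parents. -/
theorem IsLevelling.mem_of_adj (hlev : IsLevelling G k L) {x t : V} (hx : x ∈ L k)
    (ht : t ∈ lowerLevels L k) (htx : G.Adj t x) : 1 ≤ k ∧ t ∈ L (k - 1) := by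
  obtain ⟨j, hj, htj⟩ := mem_lowerLevels.1 ht
  refine ⟨by omega, ?_⟩
  have hjk : j = k - 1 := by
    by_contra hne
    exact (hlev.2.2 k (by omega) le_rfl x hx).2 j (by omega) t htj htx
  exact hjk ▸ htj

theorem IsLevelling.exists_parent (hlev : IsLevelling G (k + 1) L) {x : V}
    (hx : x ∈ L (k + 1)) : ∃ t ∈ L k, G.Adj t x :=
  (hlev.2.2 (k + 1) (by omega) le_rfl x hx).1

theorem IsLevelling.exists_walk_root (hlev : IsLevelling G k L) {r : V} (hr : r ∈ L 0) {x : V}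
    (hx : x ∈ L k) :
    ∃ p : G.Walk x r, ∀ t ∈ p.support, t ≠ x → t ∈ lowerLevels L k := by
  induction k generalizing x with
  | zero =>
    obtain ⟨s, hs⟩ := hlev.2.1
    rw [hs, Set.mem_singleton_iff] at hr hx
    subst hr
    subst hx
    exact ⟨Walk.nil, by simp⟩
  | succ k ih =>
    obtain ⟨y, hy, hyx⟩ := hlev.exists_parent hx
    obtain ⟨p, hp⟩ := ih hlev.of_succ hy
    refine ⟨Walk.cons hyx.symm p, ?_⟩
    intro t ht htx
    rw [Walk.support_cons, List.mem_cons] at ht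
    rw [mem_lowerLevels]
    rcases ht with rfl | ht
    · exact absurd rfl htx
    · by_cases hty : t = y
      · exact ⟨k, by omega, hty ▸ hy⟩
      · obtain ⟨j, hj, htj⟩ := mem_lowerLevels.1 (hp t ht hty)
        exact ⟨j, by omega, htj⟩

theorem IsLevelling.exists_isInducedPath (hlev : IsLevelling G k L) {x y : V}
    (hx : x ∈ L k) (hy : y ∈ L k) :
    ∃ p : G.Walk x y, IsInducedPath G p ∧ InteriorIn G p (lowerLevels L k) := by
  obtain ⟨r, hr⟩ := hlev.2.1
  have hr0 : r ∈ L 0 := by simp [hr]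
  obtain ⟨p, hp⟩ := hlev.exists_walk_root hr0 hx
  obtain ⟨q, hq⟩ := hlev.exists_walk_root hr0 hy
  obtain ⟨s, hs, hsub⟩ := exists_isInducedPath_support_subset (p.append q.reverse)
  refine ⟨s, hs, ?_⟩
  intro t ht htx hty
  have := hsub ht
  rw [Walk.mem_support_append_iff, Walk.support_reverse, List.mem_reverse] at this
  exact this.elim (fun h => hp t h htx) (fun h => hq t h hty)

/-- Induced paths between parents extend to induced paths between their children. -/
theorem IsLevelling.exists_extend (hlev : IsLevelling G (k + 1) L) {x y x' y' : V}
    (hx : x ∈ L (k + 1)) (hy : y ∈ L (k + 1)) (hne : x ≠ y) (hxy : ¬ G.Adj x y)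
    (hx' : x' ∈ L k) (hy' : y' ∈ L k) (hxx : G.Adj x' x) (hyy : G.Adj y' y)
    (hxy' : ¬ G.Adj x' y ∨ x' = y') (hyx' : ¬ G.Adj y' x ∨ x' = y')
    (p : G.Walk x' y') (hp : IsInducedPath G p) (hint : InteriorIn G p (lowerLevels L k)) :
    ∃ q : G.Walk x y, IsInducedPath G q ∧ q.length = p.length + 2 ∧
      InteriorIn G q (lowerLevels L (k + 1)) := by
  have hcases : ∀ t ∈ p.support, t = x' ∨ t = y' ∨ t ∈ lowerLevels L k := by
    intro t ht
    by_cases h1 : t = x'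
    · exact Or.inl h1
    · by_cases h2 : t = y'
      · exact Or.inr (Or.inl h2)
      · exact Or.inr (Or.inr (hint t ht h1 h2))
  have hlower : ∀ t ∈ p.support, t ∈ lowerLevels L (k + 1) := by
    intro t ht
    rw [mem_lowerLevels]
    rcases hcases t ht with rfl | rfl | h
    · exact ⟨k, by omega, hx'⟩
    · exact ⟨k, by omega, hy'⟩
    · obtain ⟨j, hj, htj⟩ := mem_lowerLevels.1 h
      exact ⟨j, by omega, htj⟩
  have hnotAdj : ∀ z ∈ L (k + 1), ∀ t ∈ lowerLevels L k, ¬ G.Adj z t := by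
    intro z hz t ht hzt
    obtain ⟨j, hj, htj⟩ := mem_lowerLevels.1 ht
    exact (hlev.2.2 (k + 1) (by omega) le_rfl z hz).2 j (by omega) t htj hzt.symm
  refine hp.exists_extend hxx.symm hyy.symm
    (fun h => hlev.notMem_lowerLevels hx (hlower x h))
    (fun h => hlev.notMem_lowerLevels hy (hlower y h)) ?_ ?_ hne hxy hlower
  · intro t ht hxt
    rcases hcases t ht with rfl | rfl | h
    · rfl
    · exact hyx'.elim (fun h => absurd hxt.symm h) Eq.symm
    · exact absurd hxt (hnotAdj x hx t h)
  · intro t ht hyt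
    rcases hcases t ht with rfl | rfl | h
    · exact hxy'.elim (fun h => absurd hyt.symm h) id
    · rfl
    · exact absurd hyt (hnotAdj y hy t h)

/-- Odd connection is inherited by a sibling, because siblings have the same parents. -/
theorem OddConn.of_sibling (hlev : IsLevelling G k L) {x y z : V}
    (hx : x ∈ L k) (hy : y ∈ L k)
    (hpar : 1 ≤ k → ∀ w ∈ L (k - 1), (G.Adj w x ↔ G.Adj w y))
    (hzx : ¬ G.Adj x z) (hzy : ¬ G.Adj y z) (hyz : y ≠ z)
    (h : OddConn G L k x z) : OddConn G L k y z := by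
  obtain ⟨hne, p, hp, hodd, hint⟩ := h
  refine ⟨hyz, ?_⟩
  cases p with
  | nil => exact absurd rfl hne
  | @cons _ w _ hxw p =>
    have hpath := (Walk.cons_isPath_iff hxw p).1 hp.1
    have hlow : ∀ t ∈ p.support, t ≠ z → t ∈ lowerLevels L k := fun t ht htz =>
      hint t (by simp [ht]) (fun h => hpath.2 (h ▸ ht)) htz
    have hwz : w ≠ z := fun h => hzx (h ▸ hxw)
    obtain ⟨hk, hw⟩ := hlev.mem_of_adj hx (hlow w p.start_mem_support hwz) hxw.symm
    have hyw : G.Adj y w := ((hpar hk w hw).1 hxw.symm).symm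
    refine ⟨Walk.cons hyw p, hp.tail.cons hyw ?_ ?_, by simpa using hodd, ?_⟩
    · exact fun hyp => hlev.notMem_lowerLevels hy (hlow y hyp hyz)
    · intro t ht hyt
      have htz : t ≠ z := fun h => hzy (h ▸ hyt)
      obtain ⟨-, htk⟩ := hlev.mem_of_adj hy (hlow t ht htz) hyt.symm
      exact hp.eq_snd_of_adj ht ((hpar hk t htk).2 hyt.symm).symm
    · intro t ht hty htz
      rw [Walk.support_cons, List.mem_cons] at ht
      exact ht.elim (fun h => absurd h hty) (fun h => hlow t h htz)

/-- All induced paths through the lower levels between two given vertices of `T` have the same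
parity. -/
def ParityOn (G : SimpleGraph V) (L : ℕ → Set V) (k : ℕ) (T : Set V) : Prop :=
  ∀ u ∈ T, ∀ v ∈ T, ∀ p q : G.Walk u v,
    IsInducedPath G p → InteriorIn G p (lowerLevels L k) →
    IsInducedPath G q → InteriorIn G q (lowerLevels L k) →
    (Odd p.length ↔ Odd q.length)

variable {T : Set V}

/-- Odd connection between two vertices is decided by any suitable pair of parents. -/
theorem IsLevelling.oddConn_succ_iff (hlev : IsLevelling G (k + 1) L) (hT : T ⊆ L (k + 1))
    (hstable : ∀ x ∈ T, ∀ y ∈ T, ¬ G.Adj x y) (hparity : ParityOn G L (k + 1) T)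
    {x y x' y' : V} (hx : x ∈ T) (hy : y ∈ T) (hx' : x' ∈ L k) (hy' : y' ∈ L k)
    (hxx : G.Adj x' x) (hyy : G.Adj y' y) (hxy' : ¬ G.Adj x' y) (hyx' : ¬ G.Adj y' x) :
    OddConn G L (k + 1) x y ↔ OddConn G L k x' y' := by
  have hne : x ≠ y := fun h => hxy' (h ▸ hxx)
  have hne' : x' ≠ y' := fun h => hxy' (h ▸ hyy)
  have hext := hlev.exists_extend (hT hx) (hT hy) hne (hstable x hx y hy) hx' hy' hxx hyy
    (Or.inl hxy') (Or.inl hyx')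
  constructor
  · rintro ⟨-, q, hq, hodd, hint⟩
    obtain ⟨p, hp, hpint⟩ := hlev.of_succ.exists_isInducedPath hx' hy'
    obtain ⟨r, hr, hlen, hrint⟩ := hext p hp hpint
    have := (hparity x hx y hy q r hq hint hr hrint).1 hodd
    rw [hlen] at this
    exact ⟨hne', p, hp, by simpa [Nat.odd_add, parity_simps] using this, hpint⟩
  · rintro ⟨-, p, hp, hodd, hpint⟩
    obtain ⟨r, hr, hlen, hrint⟩ := hext p hp hpint
    exact ⟨hne, r, hr, by rw [hlen]; simpa [parity_simps] using hodd, hrint⟩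

/-- Vertices with a common parent are not oddly connected. -/
theorem IsLevelling.not_oddConn_of_common_parent (hlev : IsLevelling G (k + 1) L)
    (hT : T ⊆ L (k + 1)) (hstable : ∀ x ∈ T, ∀ y ∈ T, ¬ G.Adj x y)
    (hparity : ParityOn G L (k + 1) T) {x y w : V} (hx : x ∈ T) (hy : y ∈ T) (hw : w ∈ L k)
    (hwx : G.Adj w x) (hwy : G.Adj w y) : ¬ OddConn G L (k + 1) x y := by
  rintro ⟨hne, q, hq, hodd, hint⟩
  obtain ⟨r, hr, hlen, hrint⟩ := hlev.exists_extend (hT hx) (hT hy) hne (hstable x hx y hy)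
    hw hw hwx hwy (Or.inr rfl) (Or.inr rfl) Walk.nil (IsInducedPath.nil w)
    (fun t ht htw => absurd (by simpa using ht) htw)
  have := (hparity x hx y hy q r hq hint hr hrint).1 hodd
  rw [hlen] at this
  simp [Nat.odd_iff] at this

/-- Four vertices inducing a path in the odd-connection graph. -/
structure IsOddP4 (G : SimpleGraph V) (L : ℕ → Set V) (k : ℕ) (a b c d : V) : Prop where
  ab : OddConn G L k a b
  bc : OddConn G L k b c
  cd : OddConn G L k c d
  ac : ¬ OddConn G L k a c
  ad : ¬ OddConn G L k a d
  bd : ¬ OddConn G L k b d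

theorem IsOddP4.symm {a b c d : V} (h : IsOddP4 G L k a b c d) : IsOddP4 G L k d c b a :=
  ⟨h.cd.symm, h.bc.symm, h.ab.symm, fun e => h.bd e.symm, fun e => h.ad e.symm,
    fun e => h.ac e.symm⟩

/-- The third vertex of an odd `P4` has a parent adjacent to none of the others. -/
theorem IsOddP4.exists_private_parent_third {a b c d : V} (h : IsOddP4 G L (k + 1) a b c d)
    (hlev : IsLevelling G (k + 1) L) (hT : T ⊆ L (k + 1))
    (hstable : ∀ x ∈ T, ∀ y ∈ T, ¬ G.Adj x y) (hparity : ParityOn G L (k + 1) T)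
    (ha : a ∈ T) (hb : b ∈ T) (hc : c ∈ T) (hd : d ∈ T) :
    ∃ c' ∈ L k, G.Adj c' c ∧ ¬ G.Adj c' a ∧ ¬ G.Adj c' b ∧ ¬ G.Adj c' d := by
  have hdisj {x y w : V} (hx : x ∈ T) (hy : y ∈ T) (hw : w ∈ L k) (hxy : OddConn G L (k + 1) x y)
      (hwx : G.Adj w x) : ¬ G.Adj w y := fun hwy =>
    hlev.not_oddConn_of_common_parent hT hstable hparity hx hy hw hwx hwy hxy
  have hiff {x y x' y' : V} (hx : x ∈ T) (hy : y ∈ T) :=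
    hlev.oddConn_succ_iff hT hstable hparity (x' := x') (y' := y') hx hy
  by_contra hnone
  have hca : ∀ t ∈ L k, G.Adj t c → G.Adj t a := by
    intro t ht htc
    by_contra hta
    exact hnone ⟨t, ht, htc, hta, hdisj hc hb ht h.bc.symm htc, hdisj hc hd ht h.cd htc⟩
  obtain ⟨c', hc', hcc⟩ := hlev.exists_parent (hT hc)
  have hda : ∀ t ∈ L k, G.Adj t d → G.Adj t a := by
    intro t ht htd
    by_contra hta
    have hc'd := hdisj hc hd hc' h.cd hcc
    exact h.ad ((hiff ha hd hc' ht (hca c' hc' hcc) htd hc'd hta).2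
      ((hiff hc hd hc' ht hcc htd hc'd (hdisj hd hc ht h.cd.symm htd)).1 h.cd))
  obtain ⟨d', hd', hdd⟩ := hlev.exists_parent (hT hd)
  obtain ⟨b', hb', hbb⟩ := hlev.exists_parent (hT hb)
  have hb'a := hdisj hb ha hb' h.ab.symm hbb
  have hd'b := hdisj ha hb hd' h.ab (hda d' hd' hdd)
  exact h.bd ((hiff hd hb hd' hb' hdd hbb hd'b fun hb'd => hb'a (hda b' hb' hb'd)).2
    ((hiff ha hb hd' hb' (hda d' hd' hdd) hbb hd'b hb'a).1 h.ab)).symm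

/-- The first vertex of an odd `P4` has a parent adjacent to none of the others. -/
theorem IsOddP4.exists_private_parent_first {a b c d : V} (h : IsOddP4 G L (k + 1) a b c d)
    (hlev : IsLevelling G (k + 1) L) (hT : T ⊆ L (k + 1))
    (hstable : ∀ x ∈ T, ∀ y ∈ T, ¬ G.Adj x y) (hparity : ParityOn G L (k + 1) T)
    (ha : a ∈ T) (hb : b ∈ T) (hc : c ∈ T) (hd : d ∈ T) :
    ∃ a' ∈ L k, G.Adj a' a ∧ ¬ G.Adj a' b ∧ ¬ G.Adj a' c ∧ ¬ G.Adj a' d := by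
  have hdisj {x y w : V} (hx : x ∈ T) (hy : y ∈ T) (hw : w ∈ L k) (hxy : OddConn G L (k + 1) x y)
      (hwx : G.Adj w x) : ¬ G.Adj w y := fun hwy =>
    hlev.not_oddConn_of_common_parent hT hstable hparity hx hy hw hwx hwy hxy
  have hiff {x y x' y' : V} (hx : x ∈ T) (hy : y ∈ T) :=
    hlev.oddConn_succ_iff hT hstable hparity (x' := x') (y' := y') hx hy
  obtain ⟨b', hb', hbb, hb'd, hb'c, hb'a⟩ :=
    h.symm.exists_private_parent_third hlev hT hstable hparity hd hc hb ha
  by_contra hnone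
  have had : ∀ t ∈ L k, G.Adj t a → ¬ G.Adj t d := by
    intro t ht hta htd
    have htb := hdisj ha hb ht h.ab hta
    exact h.bd ((hiff hd hb ht hb' htd hbb htb hb'd).2
      ((hiff ha hb ht hb' hta hbb htb hb'a).1 h.ab)).symm
  obtain ⟨a', ha', haa⟩ := hlev.exists_parent (hT ha)
  obtain ⟨d', hd', hdd⟩ := hlev.exists_parent (hT hd)
  have ha'd := had a' ha' haa
  have ha'c : G.Adj a' c := by
    by_contra ha'c
    exact hnone ⟨a', ha', haa, hdisj ha hb ha' h.ab haa, ha'c, ha'd⟩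
  exact h.ad ((hiff ha hd ha' hd' haa hdd ha'd fun hd'a => had d' hd' hd'a hdd).2
    ((hiff hc hd ha' hd' ha'c hdd ha'd (hdisj hd hc hd' h.cd.symm hdd)).1 h.cd))

theorem oddConn_of_adj {x y : V} (h : G.Adj x y) : OddConn G L k x y := by
  refine ⟨h.ne, Walk.cons h Walk.nil, (IsInducedPath.nil y).cons h ?_ ?_, by simp, ?_⟩
  · simpa using h.ne
  · intro t ht _
    simpa using ht
  · intro t ht htx hty
    simp [htx, hty] at ht

/-- Parity passes to a set of parents, each with a child adjacent to no other one of them. -/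
theorem IsLevelling.parityOn_parents (hlev : IsLevelling G (k + 1) L) (hT : T ⊆ L (k + 1))
    (hstable : ∀ x ∈ T, ∀ y ∈ T, ¬ G.Adj x y) (hparity : ParityOn G L (k + 1) T)
    {T' : Set V} (hT' : T' ⊆ L k)
    (hchild : ∀ x' ∈ T', ∃ x ∈ T, G.Adj x' x ∧ ∀ y' ∈ T', G.Adj y' x → y' = x') :
    ParityOn G L k T' := by
  intro u hu v hv p q hp hpint hq hqint
  by_cases huv : u = v
  · subst huv
    rw [(Walk.isPath_iff_nil.1 hp.1).eq_nil, (Walk.isPath_iff_nil.1 hq.1).eq_nil]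
  · obtain ⟨x, hx, hux, hxu⟩ := hchild u hu
    obtain ⟨y, hy, hvy, hyv⟩ := hchild v hv
    have huy : ¬ G.Adj u y := fun h => huv (hyv u hu h)
    have hvx : ¬ G.Adj v x := fun h => huv (hxu v hv h).symm
    have hne : x ≠ y := fun h => huy (h ▸ hux)
    have hext := hlev.exists_extend (hT hx) (hT hy) hne (hstable x hx y hy) (hT' hu) (hT' hv)
      hux hvy (Or.inl huy) (Or.inl hvx)
    obtain ⟨p', hp', hplen, hp'int⟩ := hext p hp hpint
    obtain ⟨q', hq', hqlen, hq'int⟩ := hext q hq hqint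
    have := hparity x hx y hy p' q' hp' hp'int hq' hq'int
    rw [hplen, hqlen] at this
    simpa [parity_simps] using this

/-- Under the parity condition the odd-connection graph has no induced `P4`. -/
theorem IsLevelling.not_isOddP4 (hlev : IsLevelling G k L)
    (hparent : ∀ i, 1 ≤ i → i ≤ k - 1 → ∀ u ∈ L i, ∀ v ∈ L i, G.Adj u v →
       ∀ w ∈ L (i - 1), (G.Adj w u ↔ G.Adj w v))
    {a b c d : V} (hT : ({a, b, c, d} : Set V) ⊆ L k)
    (hstable : ∀ x ∈ ({a, b, c, d} : Set V), ∀ y ∈ ({a, b, c, d} : Set V), ¬ G.Adj x y)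
    (hparity : ParityOn G L k {a, b, c, d}) : ¬ IsOddP4 G L k a b c d := by
  intro h
  have ha : a ∈ ({a, b, c, d} : Set V) := by simp
  have hb : b ∈ ({a, b, c, d} : Set V) := by simp
  have hc : c ∈ ({a, b, c, d} : Set V) := by simp
  have hd : d ∈ ({a, b, c, d} : Set V) := by simp
  induction k generalizing a b c d with
  | zero =>
    obtain ⟨r, hr⟩ := hlev.2.1
    rw [hr] at hT
    exact h.ab.1 ((hT ha : a = r).trans (hT hb : b = r).symm)
  | succ k ih =>
    obtain ⟨a', ha', haa, ha'b, ha'c, ha'd⟩ :=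
      h.exists_private_parent_first hlev hT hstable hparity ha hb hc hd
    obtain ⟨c', hc', hcc, hc'a, hc'b, hc'd⟩ :=
      h.exists_private_parent_third hlev hT hstable hparity ha hb hc hd
    obtain ⟨d', hd', hdd, hd'c, hd'b, hd'a⟩ :=
      h.symm.exists_private_parent_first hlev hT hstable hparity hd hc hb ha
    obtain ⟨b', hb', hbb, hb'd, hb'c, hb'a⟩ :=
      h.symm.exists_private_parent_third hlev hT hstable hparity hd hc hb ha
    have hiff {x y x' y' : V} (hx : x ∈ ({a, b, c, d} : Set V))
        (hy : y ∈ ({a, b, c, d} : Set V)) :=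
      hlev.oddConn_succ_iff hT hstable hparity (x' := x') (y' := y') hx hy
    have h' : IsOddP4 G L k a' b' c' d' :=
      ⟨(hiff ha hb ha' hb' haa hbb ha'b hb'a).1 h.ab,
        (hiff hb hc hb' hc' hbb hcc hb'c hc'b).1 h.bc,
        (hiff hc hd hc' hd' hcc hdd hc'd hd'c).1 h.cd,
        fun e => h.ac ((hiff ha hc ha' hc' haa hcc ha'c hc'a).2 e),
        fun e => h.ad ((hiff ha hd ha' hd' haa hdd ha'd hd'a).2 e),
        fun e => h.bd ((hiff hb hd hb' hd' hbb hdd hb'd hd'b).2 e)⟩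
    have hnac : ¬ G.Adj a' c' := fun e => h'.ac (oddConn_of_adj e)
    have hnad : ¬ G.Adj a' d' := fun e => h'.ad (oddConn_of_adj e)
    have hnbd : ¬ G.Adj b' d' := fun e => h'.bd (oddConn_of_adj e)
    have hneac : a' ≠ c' := fun e => ha'c (e ▸ hcc)
    have hnead : a' ≠ d' := fun e => ha'd (e ▸ hdd)
    have hnebd : b' ≠ d' := fun e => hb'd (e ▸ hdd)
    have hsib {x y z : V} (hx : x ∈ L k) (hy : y ∈ L k) (hxy : G.Adj x y) (hyz : ¬ G.Adj y z)
        (hne : y ≠ z) (hxz : OddConn G L k x z) (hnyz : ¬ OddConn G L k y z) : G.Adj x z := by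
      by_contra hnxz
      exact hnyz (hxz.of_sibling hlev.of_succ hx hy
        (fun hk => hparent k hk (by omega) x hx y hy hxy) hnxz hyz hne)
    by_cases hbc : G.Adj b' c'
    · have hab : G.Adj a' b' := (hsib hb' hc' hbc (fun e => hnac e.symm) hneac.symm h'.ab.symm
        fun e => h'.ac e.symm).symm
      have hcd : G.Adj c' d' := hsib hc' hb' hbc.symm hnbd hnebd h'.cd h'.bd
      have hpath : IsInducedPath G (Walk.cons hab (Walk.cons hbc (Walk.cons hcd Walk.nil))) := by
        refine (((IsInducedPath.nil d').cons hcd ?_ ?_).cons hbc ?_ ?_).cons hab ?_ ?_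
        · simpa using hcd.ne
        · simp
        · simp [hbc.ne, hnebd]
        · simp [hnbd]
        · simp [hab.ne, hneac, hnead]
        · simp [hnac, hnad]
      have hlow {t : V} (ht : t ∈ L k) : t ∈ lowerLevels L (k + 1) :=
        mem_lowerLevels.2 ⟨k, by omega, ht⟩
      have hnot {x t : V} (hx : x ∈ L (k + 1)) (ht : t ∈ L k) : x ≠ t := fun e =>
        hlev.notMem_lowerLevels hx (hlow (e ▸ ht))
      have hadne : a ≠ d := fun e => ha'd (e ▸ haa)
      obtain ⟨q, hq, hlen, hint⟩ := hpath.exists_extend (S := lowerLevels L (k + 1))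
        haa.symm hdd.symm
        (by simp [hnot (hT ha) ha', hnot (hT ha) hb', hnot (hT ha) hc', hnot (hT ha) hd'])
        (by simp [hnot (hT hd) ha', hnot (hT hd) hb', hnot (hT hd) hc', hnot (hT hd) hd'])
        (by simp [G.adj_comm a, hb'a, hc'a, hd'a])
        (by simp [G.adj_comm d, ha'd, hb'd, hc'd])
        hadne (hstable a ha d hd)
        (by simp [hlow ha', hlow hb', hlow hc', hlow hd'])
      refine h.ad ⟨hadne, q, hq, ?_, hint⟩
      simp [hlen, Nat.odd_iff]
    · have hnab : ¬ G.Adj a' b' := fun hab =>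
        hbc (hsib hb' ha' hab.symm hnac hneac h'.bc h'.ac)
      have hncd : ¬ G.Adj c' d' := fun hcd =>
        hbc (hsib hc' hd' hcd (fun e => hnbd e.symm) hnebd.symm h'.bc.symm
          fun e => h'.bd e.symm).symm
      have hT' : ({a', b', c', d'} : Set V) ⊆ L k := by
        rintro t (rfl | rfl | rfl | rfl) <;> assumption
      refine ih hlev.of_succ (fun i hi hik => hparent i hi (by omega)) hT' ?_ ?_ h'
        (by simp) (by simp) (by simp) (by simp)
      · rintro s (rfl | rfl | rfl | rfl) t (rfl | rfl | rfl | rfl) <;>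
          first | exact G.irrefl | assumption | (rw [G.adj_comm]; assumption)
      · refine hlev.parityOn_parents hT hstable hparity hT' ?_
        rintro x' (rfl | rfl | rfl | rfl)
        · exact ⟨a, ha, haa, by simp [hb'a, hc'a, hd'a]⟩
        · exact ⟨b, hb, hbb, by simp [ha'b, hc'b, hd'b]⟩
        · exact ⟨c, hc, hcc, by simp [ha'c, hb'c, hd'c]⟩
        · exact ⟨d, hd, hdd, by simp [ha'd, hb'd, hc'd]⟩

end Levellings

theorem stmt16 [Fintype V] (G : SimpleGraph V) (k : ℕ) (L : ℕ → Set V)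
    (hlev : IsLevelling G k L)
    (hstable : ∀ x ∈ L k, ∀ y ∈ L k, ¬ G.Adj x y)
    (hparity : ∀ u ∈ L k, ∀ v ∈ L k, ∀ p q : G.Walk u v,
       IsInducedPath G p → InteriorIn G p (lowerLevels L k) →
       IsInducedPath G q → InteriorIn G q (lowerLevels L k) →
       (Odd p.length ↔ Odd q.length))
    (hparent : ∀ i, 1 ≤ i → i ≤ k - 1 → ∀ u ∈ L i, ∀ v ∈ L i, G.Adj u v →
       ∀ w ∈ L (i - 1), (G.Adj w u ↔ G.Adj w v))
    (hdep : ∀ j, j < k → ∀ u ∈ L j, ∃ w, IsDependent G L j u w)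
    (a b c d : V) (ha : a ∈ L k) (hb : b ∈ L k) (hc : c ∈ L k) (hd : d ∈ L k)
    (hdist : a ≠ b ∧ a ≠ c ∧ a ≠ d ∧ b ≠ c ∧ b ≠ d ∧ c ≠ d)
    (hab : OddConn G L k a b) (hbc : OddConn G L k b c) (hcd : OddConn G L k c d)
    (hac : ¬ OddConn G L k a c) (had : ¬ OddConn G L k a d) (hbd : ¬ OddConn G L k b d)
    (honly : ∀ x ∈ L k, ∀ y ∈ L k, OddConn G L k x y →
       ({x, y} : Set V) = {a, b} ∨ ({x, y} : Set V) = {b, c} ∨ ({x, y} : Set V) = {c, d})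
    (i : ℕ) (hi1 : 1 ≤ i) (hik : i ≤ k)
    (u v : V) (hu : u ∈ L i) (hv : v ∈ L i) (huv : G.Adj u v) :
    ∃! w, w ∈ L (i - 1) ∧ G.Adj w u ∧ G.Adj w v := by
  have hT : ({a, b, c, d} : Set V) ⊆ L k := by
    rintro t (rfl | rfl | rfl | rfl) <;> assumption
  exact absurd ⟨hab, hbc, hcd, hac, had, hbd⟩ (hlev.not_isOddP4 hparent hT
    (fun x hx y hy => hstable x (hT hx) y (hT hy))
    (fun x hx y hy => hparity x (hT hx) y (hT hy)))
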